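/- Let N ∈ ℕ, 0 < p < ∞, and let w be a weight on ℝ^N with A_r^loc(w) < ∞ for some 1 < r < ∞. Let φ : ℝ^N → ℂ be a measurable function such that for every M ∈ ℕ there exists a constant C_M with |φ(x)| ≤ C_M · e^{−M|x|} for all x ∈ ℝ^N. Then ∫_{ℝ^N} |φ(x)|^p w(x) dx < ∞, i.e. φ ∈ L_p(ℝ^N, w). (This expresses the embedding 𝒮_e(ℝ^N) ↪ L_p(ℝ^N, w) for local Muckenhoupt weights.) -/

import Mathlib

open MeasureTheory ENNReal

/-- The axis-parallel cube in `ℝ^N` with lower corner `a` and side length `l`. -/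
def cube (N : ℕ) (a : Fin N → ℝ) (l : ℝ) : Set (Fin N → ℝ) :=
  Set.univ.pi fun i => Set.Ico (a i) (a i + l)

/-- A weight on `ℝ^N`: a locally integrable function, positive almost everywhere. -/
def IsWeight {N : ℕ} (w : (Fin N → ℝ) → ℝ) : Prop :=
  LocallyIntegrable w volume ∧ ∀ᵐ x : Fin N → ℝ, 0 < w x

/-- The Muckenhoupt expression `(|Q|⁻¹∫_Q w) (|Q|⁻¹∫_Q w^{1-p'})^{p-1}` for the cube
with corner `a` and side `l`, where `p' = p/(p-1)`. -/
noncomputable def apFactor (N : ℕ) (p : ℝ) (w : (Fin N → ℝ) → ℝ)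
    (a : Fin N → ℝ) (l : ℝ) : ℝ≥0∞ :=
  ((∫⁻ x in cube N a l, ENNReal.ofReal (w x)) / ENNReal.ofReal (l ^ N)) *
    (((∫⁻ x in cube N a l, ENNReal.ofReal (w x) ^ (1 - p / (p - 1))) /
        ENNReal.ofReal (l ^ N)) ^ (p - 1))

/-- The Muckenhoupt constant `A_p(w)`: supremum over all axis-parallel cubes. -/
noncomputable def apConst (N : ℕ) (p : ℝ) (w : (Fin N → ℝ) → ℝ) : ℝ≥0∞ :=
  ⨆ (a : Fin N → ℝ) (l : ℝ) (_ : 0 < l), apFactor N p w a l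

/-- The local Muckenhoupt constant `A_p^loc(w)`: supremum over cubes of volume `≤ 1`. -/
noncomputable def apLocConst (N : ℕ) (p : ℝ) (w : (Fin N → ℝ) → ℝ) : ℝ≥0∞ :=
  ⨆ (a : Fin N → ℝ) (l : ℝ) (_ : 0 < l) (_ : l ^ N ≤ 1), apFactor N p w a l

/-- The Euclidean norm on `ℝ^N`. -/
noncomputable def euclNorm {N : ℕ} (x : Fin N → ℝ) : ℝ :=
  Real.sqrt (∑ i, (x i) ^ 2)

lemma measurableSet_cube (N : ℕ) (a : Fin N → ℝ) (l : ℝ) : MeasurableSet (cube N a l) :=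
  MeasurableSet.univ_pi fun _ => measurableSet_Ico

lemma volume_cube (N : ℕ) (a : Fin N → ℝ) (l : ℝ) :
    volume (cube N a l) = ENNReal.ofReal l ^ N := by
  simp [cube, Real.volume_pi_Ico]

lemma norm_le_euclNorm {N : ℕ} (x : Fin N → ℝ) : ‖x‖ ≤ euclNorm x := by
  refine (pi_norm_le_iff_of_nonneg (Real.sqrt_nonneg _)).2 fun i => ?_
  rw [Real.norm_eq_abs]
  exact Real.abs_le_sqrt
    (Finset.single_le_sum (f := fun j => x j ^ 2) (fun j _ => sq_nonneg _) (Finset.mem_univ i))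

lemma norm_sub_one_le_of_mem_cube {N : ℕ} {a x : Fin N → ℝ} (hx : x ∈ cube N a 1) :
    ‖a‖ - 1 ≤ ‖x‖ := by
  have h : ‖a - x‖ ≤ 1 := by
    refine (pi_norm_le_iff_of_nonneg zero_le_one).2 fun i => ?_
    have := hx i (Set.mem_univ i)
    rw [Set.mem_Ico] at this
    rw [Pi.sub_apply, Real.norm_eq_abs, abs_le]
    constructor <;> linarith
  have := norm_sub_norm_le a x
  linarith

/-- Hölder's inequality for `1 = u ^ (1 / r) * u ^ (-1 / r)` on a set. -/
lemma measure_rpow_le_lintegral_mul {α : Type*} [MeasurableSpace α] {μ : Measure α}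
    {r : ℝ} (hr : 1 < r) {u : α → ℝ≥0∞} (hu : AEMeasurable u μ)
    (h0 : ∀ᵐ x ∂μ, u x ≠ 0) (htop : ∀ᵐ x ∂μ, u x ≠ ⊤) :
    μ Set.univ ^ r ≤
      (∫⁻ x, u x ∂μ) * (∫⁻ x, u x ^ (1 - r / (r - 1)) ∂μ) ^ (r - 1) := by
  have hr0 : 0 < r := by linarith
  have hr1 : 0 < r - 1 := by linarith
  have hpq : r.HolderConjugate (r / (r - 1)) := Real.HolderConjugate.conjExponent hr
  have key := ENNReal.lintegral_mul_le_Lp_mul_Lq μ hpq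
    (hu.pow_const (1 / r)) (hu.pow_const (-(1 / r)))
  have h1 : ∫⁻ x, ((fun x => u x ^ (1 / r)) * fun x => u x ^ (-(1 / r))) x ∂μ
      = μ Set.univ := by
    rw [← lintegral_one]
    refine lintegral_congr_ae ?_
    filter_upwards [h0, htop] with x hx0 hxt
    rw [Pi.mul_apply, ← ENNReal.rpow_add _ _ hx0 hxt]
    simp
  have h2 : ∀ x, (u x ^ (1 / r)) ^ r = u x := fun x => by
    rw [← ENNReal.rpow_mul, one_div_mul_cancel hr0.ne', ENNReal.rpow_one]
  have h3 : ∀ x, (u x ^ (-(1 / r))) ^ (r / (r - 1)) = u x ^ (1 - r / (r - 1)) := fun x => by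
    rw [← ENNReal.rpow_mul]
    congr 1
    field_simp
    ring
  simp only [h1, h2, h3] at key
  calc μ Set.univ ^ r ≤ _ := ENNReal.rpow_le_rpow key hr0.le
    _ = _ := by
      rw [ENNReal.mul_rpow_of_nonneg _ _ hr0.le, ← ENNReal.rpow_mul, ← ENNReal.rpow_mul,
        one_div_mul_cancel hr0.ne', ENNReal.rpow_one]
      congr 2
      field_simp

/-- Unit cubes whose corners are at distance at most `1 / 2` have comparable weight. -/
lemma lintegral_cube_le_of_dist_le {N : ℕ} {r : ℝ} (hr : 1 < r) {w : (Fin N → ℝ) → ℝ}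
    (hw : IsWeight w) {a b : Fin N → ℝ} (hab : dist a b ≤ 1 / 2) :
    ∫⁻ x in cube N b 1, ENNReal.ofReal (w x) ≤
      apLocConst N r w * ((ENNReal.ofReal (1 / 2) ^ N) ^ r)⁻¹ *
        ∫⁻ x in cube N a 1, ENNReal.ofReal (w x) := by
  have hcoord : ∀ i, |a i - b i| ≤ 1 / 2 := fun i => by
    simpa [Real.dist_eq] using (dist_pi_le_iff (by norm_num)).1 hab i
  set S := cube N (a ⊔ b) (1 / 2)
  have hSa : S ⊆ cube N a 1 := Set.pi_mono fun i _ => by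
    have := abs_le.1 (hcoord i)
    refine Set.Ico_subset_Ico le_sup_left ?_
    rw [Pi.sup_apply]
    rcases max_cases (a i) (b i) with h | h <;> linarith
  have hSb : S ⊆ cube N b 1 := Set.pi_mono fun i _ => by
    have := abs_le.1 (hcoord i)
    refine Set.Ico_subset_Ico le_sup_right ?_
    rw [Pi.sup_apply]
    rcases max_cases (a i) (b i) with h | h <;> linarith
  have hA : (∫⁻ x in cube N b 1, ENNReal.ofReal (w x)) *
      (∫⁻ x in cube N b 1, ENNReal.ofReal (w x) ^ (1 - r / (r - 1))) ^ (r - 1)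
        ≤ apLocConst N r w := by
    have : apFactor N r w b 1 ≤ apLocConst N r w :=
      le_iSup_of_le b (le_iSup_of_le 1 (le_iSup_of_le one_pos (le_iSup_of_le (by simp) le_rfl)))
    simpa [apFactor] using this
  have hH := measure_rpow_le_lintegral_mul (μ := volume.restrict S) hr
    (u := fun x => ENNReal.ofReal (w x))
    hw.1.aestronglyMeasurable.aemeasurable.ennreal_ofReal.restrict
    (ae_restrict_of_ae (hw.2.mono fun x hx => by simpa using hx))
    (Filter.Eventually.of_forall fun x => ENNReal.ofReal_ne_top)
  rw [Measure.restrict_apply_univ, volume_cube] at hH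
  set V := (ENNReal.ofReal (1 / 2) ^ N) ^ r
  have hV0 : V ≠ 0 := by
    refine (ENNReal.rpow_pos (ENNReal.pow_pos (by simp) N) ?_).ne'
    exact ENNReal.pow_ne_top ENNReal.ofReal_ne_top
  have hVt : V ≠ ⊤ :=
    ENNReal.rpow_ne_top_of_nonneg (by linarith) (ENNReal.pow_ne_top ENNReal.ofReal_ne_top)
  have hr1 : 0 ≤ r - 1 := by linarith
  have hmain : V * ∫⁻ x in cube N b 1, ENNReal.ofReal (w x) ≤
      apLocConst N r w * ∫⁻ x in cube N a 1, ENNReal.ofReal (w x) := by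
    calc V * ∫⁻ x in cube N b 1, ENNReal.ofReal (w x)
        ≤ ((∫⁻ x in cube N a 1, ENNReal.ofReal (w x)) *
          (∫⁻ x in cube N b 1, ENNReal.ofReal (w x) ^ (1 - r / (r - 1))) ^ (r - 1)) *
          ∫⁻ x in cube N b 1, ENNReal.ofReal (w x) := by
          gcongr ?_ * _
          refine hH.trans ?_
          gcongr
      _ = ((∫⁻ x in cube N b 1, ENNReal.ofReal (w x)) *
          (∫⁻ x in cube N b 1, ENNReal.ofReal (w x) ^ (1 - r / (r - 1))) ^ (r - 1)) *
          ∫⁻ x in cube N a 1, ENNReal.ofReal (w x) := by ring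
      _ ≤ _ := by gcongr
  calc ∫⁻ x in cube N b 1, ENNReal.ofReal (w x)
      = V⁻¹ * (V * ∫⁻ x in cube N b 1, ENNReal.ofReal (w x)) := by
        rw [← mul_assoc, ENNReal.inv_mul_cancel hV0 hVt, one_mul]
    _ ≤ V⁻¹ * (apLocConst N r w * ∫⁻ x in cube N a 1, ENNReal.ofReal (w x)) := by gcongr
    _ = _ := by ring

/-- A local Muckenhoupt weight grows at most exponentially along unit cubes. -/
lemma exists_lintegral_cube_le_exp {N : ℕ} {r : ℝ} (hr : 1 < r) {w : (Fin N → ℝ) → ℝ}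
    (hw : IsWeight w) (hfin : apLocConst N r w < ⊤) :
    ∃ L : ℝ, ∀ a : Fin N → ℝ, ∫⁻ x in cube N a 1, ENNReal.ofReal (w x) ≤
      ENNReal.ofReal (Real.exp (L * (2 * ‖a‖ + 1))) *
        ∫⁻ x in cube N 0 1, ENNReal.ofReal (w x) := by
  set B := apLocConst N r w * ((ENNReal.ofReal (1 / 2) ^ N) ^ r)⁻¹ with hB
  have hBt : B ≠ ⊤ := by
    refine ENNReal.mul_ne_top hfin.ne (ENNReal.inv_ne_top.2 ?_)
    refine (ENNReal.rpow_pos (ENNReal.pow_pos (by simp) N) ?_).ne'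
    exact ENNReal.pow_ne_top ENNReal.ofReal_ne_top
  have hBL : B ≤ ENNReal.ofReal (Real.exp B.toReal) := by
    rw [ENNReal.le_ofReal_iff_toReal_le hBt (Real.exp_pos _).le]
    linarith [Real.add_one_le_exp B.toReal]
  refine ⟨B.toReal, fun a => ?_⟩
  set m := ⌈2 * ‖a‖⌉₊
  have hm1 : 2 * ‖a‖ ≤ m := Nat.le_ceil _
  have hm2 : (m : ℝ) ≤ 2 * ‖a‖ + 1 := (Nat.ceil_lt_add_one (by positivity)).le
  have hstep : ‖((m : ℝ)⁻¹) • a‖ ≤ 1 / 2 := by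
    rw [norm_smul, norm_inv, Real.norm_natCast]
    rcases (Nat.cast_nonneg m : (0 : ℝ) ≤ m).eq_or_lt with h | h
    · rw [← h]; norm_num
    · rw [inv_mul_le_iff₀ h]; linarith
  have hind : ∀ j : ℕ, ∫⁻ x in cube N ((j : ℝ) • ((m : ℝ)⁻¹) • a) 1, ENNReal.ofReal (w x) ≤
      B ^ j * ∫⁻ x in cube N 0 1, ENNReal.ofReal (w x) := by
    intro j
    induction j with
    | zero => simp
    | succ j ih =>
      refine (lintegral_cube_le_of_dist_le hr hw
        (a := (j : ℝ) • ((m : ℝ)⁻¹) • a) ?_).trans ?_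
      · rw [dist_comm, dist_eq_norm, ← sub_smul]
        simpa using hstep
      · rw [← hB, pow_succ', mul_assoc B]
        exact mul_le_mul_right ih B
  have hma : (m : ℝ) • ((m : ℝ)⁻¹) • a = a := by
    rcases eq_or_ne (m : ℝ) 0 with h | h
    · have : a = 0 := norm_le_zero_iff.1 (by linarith)
      simp [this]
    · exact smul_inv_smul₀ h a
  have := hind m
  rw [hma] at this
  refine this.trans ?_
  gcongr
  calc B ^ m ≤ ENNReal.ofReal (Real.exp B.toReal) ^ m := by gcongr
    _ = ENNReal.ofReal (Real.exp (m * B.toReal)) := by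
      rw [← ENNReal.ofReal_pow (Real.exp_pos _).le, ← Real.exp_nat_mul]
    _ ≤ _ := by
      rw [mul_comm]
      gcongr

lemma measurableSet_setOf_mem_cube (N : ℕ) (l : ℝ) :
    MeasurableSet {q : (Fin N → ℝ) × (Fin N → ℝ) | q.1 ∈ cube N q.2 l} := by
  simp only [cube, Set.mem_univ_pi, Set.mem_Ico]
  measurability

lemma volume_setOf_mem_cube_one {N : ℕ} (x : Fin N → ℝ) :
    volume {a : Fin N → ℝ | x ∈ cube N a 1} = 1 := by
  have : {a : Fin N → ℝ | x ∈ cube N a 1} = Set.univ.pi fun i => Set.Ioc (x i - 1) (x i) := by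
    ext a
    simp only [cube, Set.mem_ofPred_eq, Set.mem_univ_pi, Set.mem_Ico, Set.mem_Ioc]
    exact forall_congr' fun i => ⟨fun h => ⟨by linarith, h.1⟩, fun h => ⟨h.2, by linarith⟩⟩
  rw [this, Real.volume_pi_Ioc]
  simp

/-- Averaging over all unit cubes recovers the integral. -/
lemma lintegral_eq_lintegral_lintegral_cube {N : ℕ} (μ : Measure (Fin N → ℝ)) [SFinite μ]
    {f : (Fin N → ℝ) → ℝ≥0∞} (hf : Measurable f) :
    ∫⁻ x, f x ∂μ = ∫⁻ a : Fin N → ℝ, ∫⁻ x in cube N a 1, f x ∂μ := by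
  have hE := measurableSet_setOf_mem_cube N 1
  calc ∫⁻ x, f x ∂μ
      = ∫⁻ x, (∫⁻ a : Fin N → ℝ, {a | x ∈ cube N a 1}.indicator (fun _ => f x) a) ∂μ := by
        refine lintegral_congr fun x => ?_
        have hx : MeasurableSet {a : Fin N → ℝ | x ∈ cube N a 1} := measurable_prodMk_left hE
        rw [lintegral_indicator_const hx, volume_setOf_mem_cube_one, mul_one]
    _ = ∫⁻ a : Fin N → ℝ, ∫⁻ x, {a | x ∈ cube N a 1}.indicator (fun _ => f x) a ∂μ :=
        lintegral_lintegral_swap ((hf.comp measurable_fst).indicator hE).aemeasurable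
    _ = _ := by
        refine lintegral_congr fun a => ?_
        rw [← lintegral_indicator (measurableSet_cube N a 1)]
        rfl

lemma lintegral_exp_neg_norm_lt_top {N : ℕ} {c : ℝ} (hc : (N : ℝ) + 1 ≤ c) :
    ∫⁻ x : Fin N → ℝ, ENNReal.ofReal (Real.exp (-c * ‖x‖)) < ⊤ := by
  refine lt_of_le_of_lt (lintegral_mono fun x => ENNReal.ofReal_le_ofReal ?_)
    (finite_integral_one_add_norm (μ := (volume : Measure (Fin N → ℝ))) (r := (N : ℝ) + 1) (by simp))
  have h0 := norm_nonneg x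
  rw [Real.rpow_def_of_pos (by linarith)]
  refine Real.exp_le_exp.2 ?_
  have h1 : Real.log (1 + ‖x‖) ≤ ‖x‖ := by
    linarith [Real.log_le_sub_one_of_pos (show 0 < 1 + ‖x‖ by linarith)]
  nlinarith [mul_le_mul_of_nonneg_right hc h0,
    mul_le_mul_of_nonneg_right h1 (by positivity : (0 : ℝ) ≤ N + 1)]

lemma lintegral_cube_lt_top {N : ℕ} {w : (Fin N → ℝ) → ℝ} (hw : LocallyIntegrable w volume)
    (a : Fin N → ℝ) (l : ℝ) : ∫⁻ x in cube N a l, ENNReal.ofReal (w x) < ⊤ := by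
  have hsub : cube N a l ⊆ Set.Icc a (fun i => a i + l) := fun x hx =>
    ⟨fun i => (hx i trivial).1, fun i => (hx i trivial).2.le⟩
  exact ((hw.integrableOn_isCompact isCompact_Icc).mono_set hsub).lintegral_lt_top

/-- Embedding `𝒮_e(ℝ^N) ↪ L_p(ℝ^N, w)`: if `w ∈ A_r^loc` for some `1 < r < ∞` and `φ` is
measurable with `|φ(x)| ≤ C_M e^{-M|x|}` for every `M ∈ ℕ`, then `∫ |φ|^p w < ∞`. -/
theorem exponential_decay_mem_weighted_Lp (N : ℕ) (hN : 0 < N) (p : ℝ) (hp : 0 < p)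
    (w : (Fin N → ℝ) → ℝ) (hw : IsWeight w)
    (r : ℝ) (hr : 1 < r) (hfin : apLocConst N r w < ⊤)
    (φ : (Fin N → ℝ) → ℂ) (hφm : Measurable φ)
    (hφ : ∀ M : ℕ, ∃ C : ℝ, ∀ x : Fin N → ℝ, ‖φ x‖ ≤ C * Real.exp (-(M : ℝ) * euclNorm x)) :
    ∫⁻ x : Fin N → ℝ, ENNReal.ofReal (‖φ x‖ ^ p) * ENNReal.ofReal (w x) < ⊤ := by
  obtain ⟨L, hL⟩ := exists_lintegral_cube_le_exp hr hw hfin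
  obtain ⟨M, hM⟩ := exists_nat_ge ((2 * L + (N + 1)) / p)
  rw [div_le_iff₀ hp] at hM
  obtain ⟨C, hC⟩ := hφ M
  have hwm : AEMeasurable (fun x => ENNReal.ofReal (w x)) volume :=
    hw.1.aestronglyMeasurable.aemeasurable.ennreal_ofReal
  set μ : Measure (Fin N → ℝ) := volume.withDensity fun x => ENNReal.ofReal (w x)
  have hf : Measurable fun x => ENNReal.ofReal (‖φ x‖ ^ p) :=
    (hφm.norm.pow_const p).ennreal_ofReal
  have hμ : ∀ a, μ (cube N a 1) = ∫⁻ x in cube N a 1, ENNReal.ofReal (w x) := fun a =>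
    withDensity_apply _ (measurableSet_cube N a 1)
  have hbound : ∀ a, ∀ x ∈ cube N a 1,
      ‖φ x‖ ^ p ≤ |C| ^ p * Real.exp (-(M * p) * (‖a‖ - 1)) := by
    intro a x hx
    have h1 : ‖a‖ - 1 ≤ euclNorm x :=
      (norm_sub_one_le_of_mem_cube hx).trans (norm_le_euclNorm x)
    have h2 : ‖φ x‖ ≤ |C| * Real.exp (-(M : ℝ) * (‖a‖ - 1)) := by
      refine (hC x).trans ?_
      refine mul_le_mul (le_abs_self C) (Real.exp_le_exp.2 ?_) (Real.exp_pos _).le (abs_nonneg C)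
      nlinarith [mul_le_mul_of_nonneg_left h1 (Nat.cast_nonneg M : (0 : ℝ) ≤ M)]
    refine (Real.rpow_le_rpow (norm_nonneg _) h2 hp.le).trans_eq ?_
    rw [Real.mul_rpow (abs_nonneg C) (Real.exp_pos _).le, ← Real.exp_mul]
    ring_nf
  have hcube : ∀ a : Fin N → ℝ, ∫⁻ x in cube N a 1, ENNReal.ofReal (‖φ x‖ ^ p) ∂μ ≤
      ENNReal.ofReal (|C| ^ p * Real.exp (M * p + L)) * μ (cube N 0 1) *
        ENNReal.ofReal (Real.exp (-(M * p - 2 * L) * ‖a‖)) := by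
    intro a
    calc ∫⁻ x in cube N a 1, ENNReal.ofReal (‖φ x‖ ^ p) ∂μ
        ≤ ∫⁻ _ in cube N a 1,
            ENNReal.ofReal (|C| ^ p * Real.exp (-(M * p) * (‖a‖ - 1))) ∂μ :=
          setLIntegral_mono' (measurableSet_cube N a 1) fun x hx =>
            ENNReal.ofReal_le_ofReal (hbound a x hx)
      _ = ENNReal.ofReal (|C| ^ p * Real.exp (-(M * p) * (‖a‖ - 1))) * μ (cube N a 1) := by
          rw [setLIntegral_const]
      _ ≤ ENNReal.ofReal (|C| ^ p * Real.exp (-(M * p) * (‖a‖ - 1))) *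
            (ENNReal.ofReal (Real.exp (L * (2 * ‖a‖ + 1))) * μ (cube N 0 1)) := by
          rw [hμ, hμ]
          gcongr
          exact hL a
      _ = _ := by
          rw [← mul_assoc, mul_right_comm _ (μ (cube N 0 1)),
            ← ENNReal.ofReal_mul (by positivity), ← ENNReal.ofReal_mul (by positivity),
            mul_assoc (|C| ^ p), mul_assoc (|C| ^ p), ← Real.exp_add, ← Real.exp_add]
          ring_nf
  calc ∫⁻ x : Fin N → ℝ, ENNReal.ofReal (‖φ x‖ ^ p) * ENNReal.ofReal (w x)
      = ∫⁻ x, ENNReal.ofReal (‖φ x‖ ^ p) ∂μ := by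
        rw [lintegral_withDensity_eq_lintegral_mul₀ hwm hf.aemeasurable]
        exact lintegral_congr fun x => mul_comm _ _
    _ = ∫⁻ a : Fin N → ℝ, ∫⁻ x in cube N a 1, ENNReal.ofReal (‖φ x‖ ^ p) ∂μ :=
        lintegral_eq_lintegral_lintegral_cube μ hf
    _ ≤ _ := lintegral_mono hcube
    _ = _ := lintegral_const_mul' _ _
        (ENNReal.mul_ne_top ENNReal.ofReal_ne_top (hμ 0 ▸ (lintegral_cube_lt_top hw.1 0 1).ne))
    _ < ⊤ := ENNReal.mul_lt_top
        (ENNReal.mul_lt_top ENNReal.ofReal_lt_top (hμ 0 ▸ lintegral_cube_lt_top hw.1 0 1))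
        (lintegral_exp_neg_norm_lt_top (by linarith))
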